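/- There is no weakly admissible continuous map u : Δ^{S_4}_{(2)} → U(4); in particular there is no admissible continuous map on the 2-skeleton of Δ^{S_4}. -/

import Mathlib

/-- The permutation matrix `U_g`, with `U_g e_i = e_{g i}`. -/
def permMat {n : ℕ} (g : Equiv.Perm (Fin n)) : Matrix (Fin n) (Fin n) ℂ :=
  Matrix.of fun i j => if i = g j then 1 else 0

/-- `i` and `j` lie in the same orbit of the subgroup `G` of `S_n`. -/
def sameOrbit {n : ℕ} (G : Subgroup (Equiv.Perm (Fin n))) (i j : Fin n) : Prop :=
  ∃ p ∈ G, p i = j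

/-- The subgroup of `S_n` generated by the differences `g⁻¹ * h` of elements of `S`;
for `S = {g₀, …, g_l}` it is the subgroup generated by `g₀⁻¹g₁, …, g₀⁻¹g_l`. -/
def groupOf {n : ℕ} (S : Finset (Equiv.Perm (Fin n))) : Subgroup (Equiv.Perm (Fin n)) :=
  Subgroup.closure {q | ∃ g ∈ S, ∃ h ∈ S, q = g⁻¹ * h}

/-- The `k`-skeleton `Δ^{S_n}_{(k)}` of the simplex with vertices indexed by `S_n`:
points of the simplex with at most `k+1` nonzero coordinates. -/
def skel (n k : ℕ) : Set (Equiv.Perm (Fin n) → ℝ) :=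
  {x | (∀ g, 0 ≤ x g) ∧ (∑ g, x g) = 1 ∧
    (Finset.univ.filter fun g => x g ≠ 0).card ≤ k + 1}

/-- The vertex of the simplex corresponding to `g ∈ S_n`. -/
def vertex {n : ℕ} (g : Equiv.Perm (Fin n)) : Equiv.Perm (Fin n) → ℝ :=
  fun h => if h = g then 1 else 0

/-- A weakly admissible map on the `k`-skeleton: a continuous map `u` into `U(n)` such
that for every subsimplex `Δ^{g₀,…,g_l}` (support finset `S`, `l ≤ k`) and every point `x`
of it, `u x` lies in the coset `U_g · U(𝒫(Δ^{g₀,…,g_l}))` for `g ∈ S`; equivalently the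
matrix `U_g⁻¹ · u x`, whose `(i,j)` entry is `u x (g i) j`, is block diagonal for the
orbit partition of the subgroup generated by the `g₀⁻¹gᵢ`. -/
def WeaklyAdmissible (n k : ℕ)
    (u : (Equiv.Perm (Fin n) → ℝ) → Matrix (Fin n) (Fin n) ℂ) : Prop :=
  ContinuousOn u (skel n k) ∧
  (∀ x ∈ skel n k, u x ∈ Matrix.unitaryGroup (Fin n) ℂ) ∧
  ∀ S : Finset (Equiv.Perm (Fin n)), S.Nonempty → S.card ≤ k + 1 →
    ∀ x ∈ skel n k, (∀ g ∉ S, x g = 0) →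
      ∀ g ∈ S, ∀ i j : Fin n, ¬ sameOrbit (groupOf S) i j → u x (g i) j = 0

/-- An admissible map on the `k`-skeleton: weakly admissible and sending every vertex `g`
to the permutation matrix `U_g`. -/
def Admissible (n k : ℕ)
    (u : (Equiv.Perm (Fin n) → ℝ) → Matrix (Fin n) (Fin n) ℂ) : Prop :=
  WeaklyAdmissible n k u ∧ ∀ g : Equiv.Perm (Fin n), u (vertex g) = permMat g

theorem sub_eq_sub_of_exp_eqOn {X : Type*} [TopologicalSpace X] {s : Set X}
    (hs : IsPreconnected s) {L L' : X → ℂ} (hL : ContinuousOn L s) (hL' : ContinuousOn L' s)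
    (h : ∀ x ∈ s, Complex.exp (L x) = Complex.exp (L' x)) {a b : X} (ha : a ∈ s) (hb : b ∈ s) :
    L b - L a = L' b - L' a := by
  have key : Set.EqOn (fun x => L x + (L' a - L a)) L' s := by
    refine Complex.isCoveringMap_exp.eqOn_of_comp_eqOn hs (by fun_prop) hL' ?_ ha (by simp)
    intro x hx
    simp [Complex.exp_add, Complex.exp_sub, h x hx, h a ha]
  linear_combination key hb

section LogIncr

variable {E : Type*} [AddCommGroup E] [Module ℝ E]

open Classical in
/-- The increment along the segment `[a, b]` of a continuous logarithm of `f`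
(zero if there is no such logarithm). -/
noncomputable def logIncr [TopologicalSpace E] (f : E → ℂ) (a b : E) : ℂ :=
  if h : ∃ L : E → ℂ, ContinuousOn L (segment ℝ a b) ∧
      ∀ x ∈ segment ℝ a b, Complex.exp (L x) = f x then
    h.choose b - h.choose a
  else 0

variable [TopologicalSpace E] [IsTopologicalAddGroup E] [ContinuousSMul ℝ E]

theorem logIncr_eq {f L : E → ℂ} {a b : E} (hL : ContinuousOn L (segment ℝ a b))
    (h : ∀ x ∈ segment ℝ a b, Complex.exp (L x) = f x) : logIncr f a b = L b - L a := by
  have H : ∃ L : E → ℂ, ContinuousOn L (segment ℝ a b) ∧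
      ∀ x ∈ segment ℝ a b, Complex.exp (L x) = f x := ⟨L, hL, h⟩
  rw [logIncr, dif_pos H]
  exact sub_eq_sub_of_exp_eqOn (convex_segment a b).isPreconnected H.choose_spec.1 hL
    (fun x hx => (H.choose_spec.2 x hx).trans (h x hx).symm)
    (left_mem_segment ℝ a b) (right_mem_segment ℝ a b)

theorem Convex.exists_continuousOn_exp_eq [LocallyConvexSpace ℝ E] {s : Set E} (hs : Convex ℝ s)
    {f : E → ℂ} (hf : ContinuousOn f s) (h0 : ∀ x ∈ s, f x ≠ 0) :
    ∃ L : E → ℂ, ContinuousOn L s ∧ ∀ x ∈ s, Complex.exp (L x) = f x := by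
  classical
  rcases s.eq_empty_or_nonempty with rfl | hne
  · exact ⟨0, by simp, by simp⟩
  have := hs.contractibleSpace hne
  have := hs.locallyPathConnectedSpace
  obtain ⟨x₀, hx₀⟩ := hne
  obtain ⟨F, ⟨-, hF⟩, -⟩ := Complex.isCoveringMapOn_exp.existsUnique_continuousMap_lifts
    ⟨fun x : s => f x, continuousOn_iff_continuous_domRestrict.mp hf⟩ (a₀ := ⟨x₀, hx₀⟩)
    (Complex.exp_log (h0 x₀ hx₀)) (fun x => h0 x x.2)
  refine ⟨fun x => if hx : x ∈ s then F ⟨x, hx⟩ else 0, ?_, fun x hx => ?_⟩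
  · rw [continuousOn_iff_continuous_domRestrict]
    convert map_continuous F using 1
    ext x
    simp
  · simp only [dif_pos hx]
    exact congrFun hF ⟨x, hx⟩

variable [LocallyConvexSpace ℝ E] {s : Set E} {f g k : E → ℂ} {a b c : E}

theorem logIncr_add (hs : Convex ℝ s) (hf : ContinuousOn f s) (h0 : ∀ x ∈ s, f x ≠ 0)
    (ha : a ∈ s) (hb : b ∈ s) (hc : c ∈ s) :
    logIncr f a b + logIncr f b c = logIncr f a c := by
  obtain ⟨L, hL, h⟩ := hs.exists_continuousOn_exp_eq hf h0
  have key : ∀ {p q}, p ∈ s → q ∈ s → logIncr f p q = L q - L p := fun hp hq =>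
    logIncr_eq (hL.mono (hs.segment_subset hp hq)) fun x hx => h x (hs.segment_subset hp hq hx)
  rw [key ha hb, key hb hc, key ha hc]
  ring

theorem exp_logIncr (hs : Convex ℝ s) (hf : ContinuousOn f s) (h0 : ∀ x ∈ s, f x ≠ 0)
    (ha : a ∈ s) (hb : b ∈ s) : Complex.exp (logIncr f a b) = f b / f a := by
  obtain ⟨L, hL, h⟩ := hs.exists_continuousOn_exp_eq hf h0
  rw [logIncr_eq (hL.mono (hs.segment_subset ha hb))
    fun x hx => h x (hs.segment_subset ha hb hx), Complex.exp_sub, h a ha, h b hb]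

theorem logIncr_mul (hs : Convex ℝ s) (hf : ContinuousOn f s) (hf0 : ∀ x ∈ s, f x ≠ 0)
    (hg : ContinuousOn g s) (hg0 : ∀ x ∈ s, g x ≠ 0) {z : ℂ} (hz : z ≠ 0)
    (hk : ∀ x ∈ s, k x = z * (f x * g x)) (ha : a ∈ s) (hb : b ∈ s) :
    logIncr k a b = logIncr f a b + logIncr g a b := by
  obtain ⟨L, hL, h⟩ := hs.exists_continuousOn_exp_eq hf hf0
  obtain ⟨L', hL', h'⟩ := hs.exists_continuousOn_exp_eq hg hg0
  have hab := hs.segment_subset ha hb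
  rw [logIncr_eq (hL.mono hab) fun x hx => h x (hab hx),
    logIncr_eq (hL'.mono hab) fun x hx => h' x (hab hx),
    logIncr_eq (L := fun x => Complex.log z + (L x + L' x))]
  · ring
  · exact continuousOn_const.add ((hL.mono hab).add (hL'.mono hab))
  · intro x hx
    rw [Complex.exp_add, Complex.exp_add, Complex.exp_log hz, h x (hab hx), h' x (hab hx),
      hk x (hab hx)]

end LogIncr

open Equiv (Perm swap)

/-- The closed face of the simplex spanned by the vertices in `S`. -/
def face {n : ℕ} (S : Finset (Perm (Fin n))) : Set (Perm (Fin n) → ℝ) :=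
  {x | (∀ g, 0 ≤ x g) ∧ (∑ g, x g) = 1 ∧ ∀ g ∉ S, x g = 0}

theorem convex_face {n : ℕ} (S : Finset (Perm (Fin n))) : Convex ℝ (face S) := by
  rintro x ⟨hx0, hx1, hxS⟩ y ⟨hy0, hy1, hyS⟩ a b ha hb hab
  refine ⟨fun g => ?_, ?_, fun g hg => ?_⟩
  · have := mul_nonneg ha (hx0 g)
    have := mul_nonneg hb (hy0 g)
    simp only [Pi.add_apply, Pi.smul_apply, smul_eq_mul]
    positivity
  · simp [Finset.sum_add_distrib, ← Finset.mul_sum, hx1, hy1, hab]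
  · simp [hxS g hg, hyS g hg]

theorem vertex_mem_face {n : ℕ} {S : Finset (Perm (Fin n))} {g : Perm (Fin n)} (hg : g ∈ S) :
    vertex g ∈ face S := by
  refine ⟨fun h => ?_, by simp [vertex], fun h hh => ?_⟩
  · unfold vertex
    split_ifs <;> norm_num
  · simp [vertex, ne_of_mem_of_not_mem hg hh |>.symm]

theorem face_subset_skel {n k : ℕ} {S : Finset (Perm (Fin n))} (hS : S.card ≤ k + 1) :
    face S ⊆ skel n k := by
  rintro x ⟨hx0, hx1, hxS⟩
  refine ⟨hx0, hx1, (Finset.card_le_card fun g hg => ?_).trans hS⟩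
  by_contra hgS
  simp [hxS g hgS] at hg

theorem sameOrbit_groupOf_iff {n : ℕ} {S : Finset (Perm (Fin n))} {A P : Set (Fin n)}
    (h : ∀ g ∈ S, ∀ i, g i ∈ A ↔ i ∈ P) {i j : Fin n} (hij : sameOrbit (groupOf S) i j) :
    i ∈ P ↔ j ∈ P := by
  obtain ⟨q, hq, rfl⟩ := hij
  suffices ∀ i, i ∈ P ↔ q i ∈ P from this i
  induction hq using Subgroup.closure_induction with
  | mem x hx =>
    obtain ⟨g, hg, k, hk, rfl⟩ := hx
    intro i
    rw [← h k hk, ← h g hg]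
    simp
  | one => simp
  | mul x y _ _ hx hy => intro i; rw [hy i, hx (y i), Equiv.Perm.mul_apply]
  | inv x _ hx => intro i; rw [hx (x⁻¹ i)]; simp

theorem WeaklyAdmissible.apply_eq_zero {n k : ℕ}
    {u : (Perm (Fin n) → ℝ) → Matrix (Fin n) (Fin n) ℂ} (hu : WeaklyAdmissible n k u)
    {S : Finset (Perm (Fin n))} (hS : S.card ≤ k + 1) {A P : Set (Fin n)}
    (h : ∀ g ∈ S, ∀ i, g i ∈ A ↔ i ∈ P) {x : Perm (Fin n) → ℝ} (hx : x ∈ face S)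
    {a j : Fin n} (haj : ¬ (a ∈ A ↔ j ∈ P)) : u x a j = 0 := by
  have hne : S.Nonempty := by
    by_contra hne
    rw [Finset.not_nonempty_iff_eq_empty] at hne
    subst hne
    have := hx.2.1
    simp [hx.2.2] at this
  obtain ⟨g, hg⟩ := hne
  have := hu.2.2 S ⟨g, hg⟩ hS x (face_subset_skel hS hx) hx.2.2 g hg (g⁻¹ a) j fun ho => haj <| by
    rw [← sameOrbit_groupOf_iff h ho, ← h g hg]
    simp
  simpa using this

theorem WeaklyAdmissible.det_ne_zero {n k : ℕ}
    {u : (Perm (Fin n) → ℝ) → Matrix (Fin n) (Fin n) ℂ} (hu : WeaklyAdmissible n k u)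
    {x : Perm (Fin n) → ℝ} (hx : x ∈ skel n k) : (u x).det ≠ 0 :=
  (Matrix.UnitaryGroup.det_isUnit ⟨u x, hu.2.1 x hx⟩).ne_zero

theorem WeaklyAdmissible.entry_ne_zero {n k : ℕ}
    {u : (Perm (Fin n) → ℝ) → Matrix (Fin n) (Fin n) ℂ} (hu : WeaklyAdmissible n k u)
    {S : Finset (Perm (Fin n))} (hS : S.card ≤ k + 1) {a j : Fin n} (h : ∀ g ∈ S, g j = a)
    {x : Perm (Fin n) → ℝ} (hx : x ∈ face S) : u x a j ≠ 0 := by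
  intro h0
  refine hu.det_ne_zero (face_subset_skel hS hx)
    (Matrix.det_eq_zero_of_column_eq_zero j fun i => ?_)
  by_cases hi : i = a
  · rwa [hi]
  · refine hu.apply_eq_zero hS (A := {a}) (P := {j}) (fun g hg m => ?_) hx (by simpa using hi)
    simp [← h g hg]

theorem WeaklyAdmissible.continuousOn_entry {n k : ℕ}
    {u : (Perm (Fin n) → ℝ) → Matrix (Fin n) (Fin n) ℂ} (hu : WeaklyAdmissible n k u)
    {S : Finset (Perm (Fin n))} (hS : S.card ≤ k + 1) (a j : Fin n) :
    ContinuousOn (fun x => u x a j) (face S) :=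
  (continuous_id.matrix_elem a j).comp_continuousOn (hu.1.mono (face_subset_skel hS))

theorem WeaklyAdmissible.continuousOn_det {n k : ℕ}
    {u : (Perm (Fin n) → ℝ) → Matrix (Fin n) (Fin n) ℂ} (hu : WeaklyAdmissible n k u)
    {S : Finset (Perm (Fin n))} (hS : S.card ≤ k + 1) :
    ContinuousOn (fun x => (u x).det) (face S) :=
  continuous_id.matrix_det.comp_continuousOn (hu.1.mono (face_subset_skel hS))

theorem WeaklyAdmissible.det_vertex {n k : ℕ}
    {u : (Perm (Fin n) → ℝ) → Matrix (Fin n) (Fin n) ℂ} (hu : WeaklyAdmissible n k u)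
    (g : Perm (Fin n)) :
    (u (vertex g)).det = Perm.sign g * ∏ j, u (vertex g) (g j) j := by
  rw [Matrix.det_apply', Finset.sum_eq_single g]
  · intro σ _ hσ
    obtain ⟨j, hj⟩ : ∃ j, σ j ≠ g j := by
      by_contra! hc
      exact hσ (Equiv.ext hc)
    refine mul_eq_zero_of_right _ (Finset.prod_eq_zero (Finset.mem_univ j) ?_)
    refine hu.apply_eq_zero (S := {g}) (by simp) (A := {g j}) (P := {j}) (fun h hh m => ?_)
      (vertex_mem_face (by simp)) (by simpa using hj)
    simp [Finset.mem_singleton.mp hh]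
  · simp

/-- A logarithm of the entry `(g j, j)` of `u` at the vertex `g`, continued from a base vertex
along permutations which agree with `g` at `j`. -/
noncomputable def phase {n : ℕ} (u : (Perm (Fin n) → ℝ) → Matrix (Fin n) (Fin n) ℂ)
    (g : Perm (Fin n)) (j : Fin n) : ℂ :=
  Complex.log (u (vertex (swap j (g j))) (g j) j) +
    logIncr (fun x => u x (g j) j) (vertex (swap j (g j))) (vertex g)

/-- The increment of `log (det u)` from the vertex `1` to the vertex `g`, with the phases of the
nonzero entries at `g` taken off. -/
noncomputable def potential {n : ℕ} (u : (Perm (Fin n) → ℝ) → Matrix (Fin n) (Fin n) ℂ)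
    (g : Perm (Fin n)) : ℂ :=
  logIncr (fun x => (u x).det) (vertex 1) (vertex g) - ∑ j, phase u g j

section Phase

variable {n : ℕ} {u : (Perm (Fin n) → ℝ) → Matrix (Fin n) (Fin n) ℂ}

theorem WeaklyAdmissible.exp_phase (hu : WeaklyAdmissible n 2 u) (g : Perm (Fin n)) (j : Fin n) :
    Complex.exp (phase u g j) = u (vertex g) (g j) j := by
  have hS : ({swap j (g j), g} : Finset (Perm (Fin n))).card ≤ 2 + 1 :=
    Finset.card_le_two.trans (by norm_num)
  have hne := fun x => hu.entry_ne_zero hS (a := g j) (j := j) (by simp) (x := x)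
  have h1 : vertex (swap j (g j)) ∈ face {swap j (g j), g} := vertex_mem_face (by simp)
  have h2 : vertex g ∈ face {swap j (g j), g} := vertex_mem_face (by simp)
  rw [phase, Complex.exp_add, Complex.exp_log (hne _ h1),
    exp_logIncr (convex_face _) (hu.continuousOn_entry hS _ _) hne h1 h2,
    mul_div_cancel₀ _ (hne _ h1)]

theorem WeaklyAdmissible.logIncr_entry (hu : WeaklyAdmissible n 2 u) {g h : Perm (Fin n)}
    {a j : Fin n} (hg : g j = a) (hh : h j = a) :
    logIncr (fun x => u x a j) (vertex g) (vertex h) = phase u h j - phase u g j := by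
  have hS : ({swap j a, g, h} : Finset (Perm (Fin n))).card ≤ 2 + 1 := Finset.card_le_three
  have := logIncr_add (convex_face {swap j a, g, h}) (hu.continuousOn_entry hS a j)
    (fun x => hu.entry_ne_zero hS (by simp [hg, hh]))
    (vertex_mem_face (g := swap j a) (by simp)) (vertex_mem_face (g := g) (by simp))
    (vertex_mem_face (g := h) (by simp))
  rw [phase, phase, hg, hh, ← this]
  ring

theorem WeaklyAdmissible.logIncr_det (hu : WeaklyAdmissible n 2 u) (g h : Perm (Fin n)) :
    logIncr (fun x => (u x).det) (vertex g) (vertex h) =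
      potential u h + ∑ j, phase u h j - (potential u g + ∑ j, phase u g j) := by
  have hS : ({1, g, h} : Finset (Perm (Fin n))).card ≤ 2 + 1 := Finset.card_le_three
  have := logIncr_add (convex_face {1, g, h}) (hu.continuousOn_det hS)
    (fun x hx => hu.det_ne_zero (face_subset_skel hS hx))
    (vertex_mem_face (g := 1) (by simp)) (vertex_mem_face (g := g) (by simp))
    (vertex_mem_face (g := h) (by simp))
  rw [potential, potential, ← this]
  ring

theorem WeaklyAdmissible.exp_potential (hu : WeaklyAdmissible n 2 u) (g : Perm (Fin n)) :
    Complex.exp (potential u g) = Perm.sign g / (u (vertex 1)).det := by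
  have hS : ({1, g} : Finset (Perm (Fin n))).card ≤ 2 + 1 :=
    Finset.card_le_two.trans (by norm_num)
  have hne := fun x hx => hu.det_ne_zero (face_subset_skel hS (a := x) hx)
  have hg : vertex g ∈ face {1, g} := vertex_mem_face (by simp)
  have hprod : ∏ j, u (vertex g) (g j) j ≠ 0 := fun h0 =>
    hne _ hg (by rw [hu.det_vertex, h0, mul_zero])
  rw [potential, Complex.exp_sub, Complex.exp_sum, exp_logIncr (convex_face _)
    (hu.continuousOn_det hS) hne (vertex_mem_face (by simp)) hg, hu.det_vertex g]
  simp only [hu.exp_phase]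
  field_simp

theorem WeaklyAdmissible.exists_potential_eq (hu : WeaklyAdmissible n 2 u) (g : Perm (Fin n)) :
    ∃ m : ℤ, potential u g = potential u 1 + m * (Real.pi * Complex.I) ∧
      (Perm.sign g = 1 → Even m) ∧ (Perm.sign g = -1 → Odd m) := by
  have h1 := hu.exp_potential 1
  have hg := hu.exp_potential g
  rcases Int.units_eq_one_or (Perm.sign g) with hs | hs
  · obtain ⟨k, hk⟩ := Complex.exp_eq_exp_iff_exists_int.mp
      (show Complex.exp (potential u g) = Complex.exp (potential u 1) by
        rw [h1, hg, hs, Perm.sign_one])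
    refine ⟨2 * k, ?_, fun _ => even_two_mul k, fun h => by simp [hs] at h⟩
    push_cast
    linear_combination hk
  · obtain ⟨k, hk⟩ := Complex.exp_eq_exp_iff_exists_int.mp
      (show Complex.exp (potential u g) = Complex.exp (potential u 1 + Real.pi * Complex.I) by
        rw [Complex.exp_add, Complex.exp_pi_mul_I, h1, hg, hs, Perm.sign_one]
        push_cast
        ring)
    refine ⟨2 * k + 1, ?_, fun h => by simp [hs] at h, fun _ => ⟨k, rfl⟩⟩
    push_cast
    linear_combination hk

end Phase

/-- The `2 × 2` minor of `M` with rows `a`, `b` and columns `i`, `j`. -/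
def minor {n : ℕ} (M : Matrix (Fin n) (Fin n) ℂ) (a b i j : Fin n) : ℂ :=
  M a i * M b j - M a j * M b i

theorem det_eq_minor_mul_minor (M : Matrix (Fin 4) (Fin 4) ℂ) (r p : Perm (Fin 4))
    (h : ∀ m l : Fin 4, ¬ (m ∈ ({0, 1} : Set (Fin 4)) ↔ l ∈ ({0, 1} : Set (Fin 4))) →
      M (r m) (p l) = 0) :
    M.det = Perm.sign r * Perm.sign p *
      (minor M (r 0) (r 1) (p 0) (p 1) * minor M (r 2) (r 3) (p 2) (p 3)) := by
  have key : Perm.sign r * Perm.sign p * M.det =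
      minor M (r 0) (r 1) (p 0) (p 1) * minor M (r 2) (r 3) (p 2) (p 3) := by
    have : (M.submatrix r p).det = Perm.sign r * Perm.sign p * M.det := by
      rw [mul_assoc, ← Matrix.det_permute', ← Matrix.det_permute]
      rfl
    rw [← this]
    have h02 := h 0 2 (by simp)
    have h03 := h 0 3 (by simp)
    have h12 := h 1 2 (by simp)
    have h13 := h 1 3 (by simp)
    have h20 := h 2 0 (by simp)
    have h21 := h 2 1 (by simp)
    have h30 := h 3 0 (by simp)
    have h31 := h 3 1 (by simp)
    simp [Matrix.det_succ_row_zero, Fin.sum_univ_succ, Fin.succAbove, minor, h02, h03, h12, h13,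
      h20, h21, h30, h31]
    ring
  rw [← key]
  rcases Int.units_eq_one_or (Perm.sign r) with hr | hr <;>
    rcases Int.units_eq_one_or (Perm.sign p) with hp | hp <;> simp [hr, hp]

section Square

variable {u : (Perm (Fin 4) → ℝ) → Matrix (Fin 4) (Fin 4) ℂ}

theorem WeaklyAdmissible.logIncr_minor (hu : WeaklyAdmissible 4 2 u) {g h : Perm (Fin 4)}
    {a b i j : Fin 4} (hij : i ≠ j) (hgi : g i = a) (hgj : g j = b) (hhi : h i = a) (hhj : h j = b)
    {z : ℂ} (hz : z ≠ 0) {f : (Perm (Fin 4) → ℝ) → ℂ} (hf : ∀ x, f x = z * minor (u x) a b i j) :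
    logIncr f (vertex g) (vertex h) =
      phase u h i - phase u g i + (phase u h j - phase u g j) := by
  have hS : ({g, h} : Finset (Perm (Fin 4))).card ≤ 2 + 1 :=
    Finset.card_le_two.trans (by norm_num)
  rw [← hu.logIncr_entry hgi hhi, ← hu.logIncr_entry hgj hhj]
  refine logIncr_mul (convex_face {g, h}) (hu.continuousOn_entry hS _ _)
    (fun x => hu.entry_ne_zero hS (by simp [hgi, hhi])) (hu.continuousOn_entry hS _ _)
    (fun x => hu.entry_ne_zero hS (by simp [hgj, hhj])) hz (fun x hx => ?_)
    (vertex_mem_face (by simp)) (vertex_mem_face (by simp))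
  have h0 : u x a j = 0 := by
    refine hu.apply_eq_zero hS (A := {a}) (P := {i}) (fun k hk m => ?_) hx (by simpa using hij.symm)
    obtain rfl | rfl : k = g ∨ k = h := by simpa using hk
    · simp [← hgi]
    · simp [← hhi]
  rw [hf, minor, h0, zero_mul, sub_zero]

theorem WeaklyAdmissible.potential_square (hu : WeaklyAdmissible 4 2 u) (r p : Perm (Fin 4)) :
    potential u (r * p⁻¹) + potential u (r * (swap 0 1 * swap 2 3) * p⁻¹) =
      potential u (r * swap 0 1 * p⁻¹) + potential u (r * swap 2 3 * p⁻¹) := by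
  obtain ⟨g₀, hg₀⟩ : ∃ g, g = r * p⁻¹ := ⟨_, rfl⟩
  obtain ⟨g₁, hg₁⟩ : ∃ g, g = r * swap 0 1 * p⁻¹ := ⟨_, rfl⟩
  obtain ⟨g₂, hg₂⟩ : ∃ g, g = r * swap 2 3 * p⁻¹ := ⟨_, rfl⟩
  obtain ⟨g₃, hg₃⟩ : ∃ g, g = r * (swap 0 1 * swap 2 3) * p⁻¹ := ⟨_, rfl⟩
  rw [← hg₀, ← hg₁, ← hg₂, ← hg₃]
  have e₀ : ∀ m, g₀ (p m) = r m := by simp [hg₀]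
  have e₁ : ∀ m, g₁ (p m) = r (swap 0 1 m) := by simp [hg₁]
  have e₂ : ∀ m, g₂ (p m) = r (swap 2 3 m) := by simp [hg₂]
  have e₃ : ∀ m, g₃ (p m) = r (swap 0 1 (swap 2 3 m)) := by simp [hg₃]
  set T : Finset (Perm (Fin 4)) := {g₀, g₁, g₂, g₃} with hT
  have block : ∀ g ∈ T, ∀ i, g i ∈ r '' {0, 1} ↔ i ∈ p '' {0, 1} := by
    intro g hg i
    obtain ⟨m, rfl⟩ := p.surjective i
    rw [p.injective.mem_set_image]
    simp only [hT, Finset.mem_insert, Finset.mem_singleton] at hg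
    rcases hg with rfl | rfl | rfl | rfl
    · rw [e₀, r.injective.mem_set_image]
    · rw [e₁, r.injective.mem_set_image]
      revert m; decide
    · rw [e₂, r.injective.mem_set_image]
      revert m; decide
    · rw [e₃, r.injective.mem_set_image]
      revert m; decide
  have hdet : ∀ S ⊆ T, S.card ≤ 2 + 1 → ∀ x ∈ face S, (u x).det =
      Perm.sign r * Perm.sign p * (minor (u x) (r 0) (r 1) (p 0) (p 1) *
        minor (u x) (r 2) (r 3) (p 2) (p 3)) := by
    intro S hST hS x hx
    refine det_eq_minor_mul_minor _ r p fun m l hml => ?_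
    refine hu.apply_eq_zero hS (fun g hg => block g (hST hg)) hx ?_
    rwa [r.injective.mem_set_image, p.injective.mem_set_image]
  have hne : ∀ S ⊆ T, S.card ≤ 2 + 1 → ∀ x ∈ face S,
      minor (u x) (r 0) (r 1) (p 0) (p 1) ≠ 0 ∧ minor (u x) (r 2) (r 3) (p 2) (p 3) ≠ 0 := by
    intro S hST hS x hx
    have := hu.det_ne_zero (face_subset_skel hS hx)
    rw [hdet S hST hS x hx] at this
    exact ⟨left_ne_zero_of_mul (right_ne_zero_of_mul this),
      right_ne_zero_of_mul (right_ne_zero_of_mul this)⟩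
  have hcont : ∀ S : Finset (Perm (Fin 4)), S.card ≤ 2 + 1 → ∀ a b i j,
      ContinuousOn (fun x => minor (u x) a b i j) (face S) := fun S hS a b i j =>
    ((hu.continuousOn_entry hS a i).mul (hu.continuousOn_entry hS b j)).sub
      ((hu.continuousOn_entry hS a j).mul (hu.continuousOn_entry hS b i))
  have hsplit : ∀ g ∈ T, ∀ h ∈ T, logIncr (fun x => (u x).det) (vertex g) (vertex h) =
      logIncr (fun x => minor (u x) (r 0) (r 1) (p 0) (p 1)) (vertex g) (vertex h) +
      logIncr (fun x => minor (u x) (r 2) (r 3) (p 2) (p 3)) (vertex g) (vertex h) := by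
    intro g hg h hh
    have hS : ({g, h} : Finset (Perm (Fin 4))).card ≤ 2 + 1 :=
      Finset.card_le_two.trans (by norm_num)
    have hST : {g, h} ⊆ T := by simp [Finset.insert_subset_iff, hg, hh]
    exact logIncr_mul (convex_face {g, h}) (hcont _ hS _ _ _ _) (fun x hx => (hne _ hST hS x hx).1)
      (hcont _ hS _ _ _ _) (fun x hx => (hne _ hST hS x hx).2)
      (by norm_cast; exact Units.ne_zero _) (hdet _ hST hS)
      (vertex_mem_face (by simp)) (vertex_mem_face (by simp))
  have hcocycle : ∀ g ∈ T, ∀ h ∈ T, ∀ k ∈ T,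
      logIncr (fun x => minor (u x) (r 0) (r 1) (p 0) (p 1)) (vertex g) (vertex h) +
      logIncr (fun x => minor (u x) (r 0) (r 1) (p 0) (p 1)) (vertex h) (vertex k) =
      logIncr (fun x => minor (u x) (r 0) (r 1) (p 0) (p 1)) (vertex g) (vertex k) := by
    intro g hg h hh k hk
    have hS : ({g, h, k} : Finset (Perm (Fin 4))).card ≤ 2 + 1 := Finset.card_le_three
    have hST : {g, h, k} ⊆ T := by simp [Finset.insert_subset_iff, hg, hh, hk]
    exact logIncr_add (convex_face {g, h, k}) (hcont _ hS _ _ _ _)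
      (fun x hx => (hne _ hST hS x hx).1) (vertex_mem_face (by simp)) (vertex_mem_face (by simp))
      (vertex_mem_face (by simp))
  have m₀ : g₀ ∈ T := by simp [hT]
  have m₁ : g₁ ∈ T := by simp [hT]
  have m₂ : g₂ ∈ T := by simp [hT]
  have m₃ : g₃ ∈ T := by simp [hT]
  have p01 : p 0 ≠ p 1 := p.injective.ne (by decide)
  have p23 : p 2 ≠ p 3 := p.injective.ne (by decide)
  have b₀₂ := hu.logIncr_minor (g := g₀) (h := g₂) p01 (e₀ 0) (e₀ 1) (e₂ 0) (e₂ 1) one_ne_zero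
    (f := fun x => minor (u x) (r 0) (r 1) (p 0) (p 1)) (fun x => (one_mul _).symm)
  have b₁₃ := hu.logIncr_minor (g := g₁) (h := g₃) p01.symm (e₁ 1) (e₁ 0) (e₃ 1) (e₃ 0)
    (neg_ne_zero.mpr one_ne_zero) (f := fun x => minor (u x) (r 0) (r 1) (p 0) (p 1))
    (fun x => show minor _ _ _ _ _ = -1 * minor _ (r 0) (r 1) _ _ by unfold minor; ring)
  have c₀₁ := hu.logIncr_minor (g := g₀) (h := g₁) p23 (e₀ 2) (e₀ 3) (e₁ 2) (e₁ 3) one_ne_zero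
    (f := fun x => minor (u x) (r 2) (r 3) (p 2) (p 3)) (fun x => (one_mul _).symm)
  have c₂₃ := hu.logIncr_minor (g := g₂) (h := g₃) p23.symm (e₂ 3) (e₂ 2) (e₃ 3) (e₃ 2)
    (neg_ne_zero.mpr one_ne_zero) (f := fun x => minor (u x) (r 2) (r 3) (p 2) (p 3))
    (fun x => show minor _ _ _ _ _ = -1 * minor _ (r 2) (r 3) _ _ by unfold minor; ring)
  have d₀₁ := hsplit g₀ m₀ g₁ m₁
  have d₂₃ := hsplit g₂ m₂ g₃ m₃
  have s₁ := hcocycle g₀ m₀ g₁ m₁ g₃ m₃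
  have s₂ := hcocycle g₀ m₀ g₂ m₂ g₃ m₃
  have sum_phase : ∀ g, ∑ j, phase u g j =
      phase u g (p 0) + phase u g (p 1) + phase u g (p 2) + phase u g (p 3) := fun g => by
    rw [← Equiv.sum_comp p, Fin.sum_univ_four]
  rw [hu.logIncr_det, sum_phase, sum_phase] at d₀₁ d₂₃
  linear_combination d₂₃ - d₀₁ + s₂ - s₁ + b₁₃ - b₀₂ + c₂₃ - c₀₁

end Square

theorem not_square_identity_of_parity (m : Perm (Fin 4) → ℤ)
    (even : ∀ g, Perm.sign g = 1 → Even (m g)) (odd : ∀ g, Perm.sign g = -1 → Odd (m g))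
    (h : ∀ r p : Perm (Fin 4), m (r * p⁻¹) + m (r * (swap 0 1 * swap 2 3) * p⁻¹) =
      m (r * swap 0 1 * p⁻¹) + m (r * swap 2 3 * p⁻¹)) : False := by
  have square : ∀ r p g₀ g₃ g₁ g₂ : Perm (Fin 4), r * p⁻¹ = g₀ →
      r * (swap 0 1 * swap 2 3) * p⁻¹ = g₃ → r * swap 0 1 * p⁻¹ = g₁ → r * swap 2 3 * p⁻¹ = g₂ →
      m g₀ + m g₃ = m g₁ + m g₂ := by
    rintro r p _ _ _ _ rfl rfl rfl rfl
    exact h r p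
  simp only [Int.even_iff, Int.odd_iff] at even odd
  have := square 1 1 1 (swap 0 1 * swap 2 3) (swap 0 1) (swap 2 3)
    (by decide) (by decide) (by decide) (by decide)
  have := square (swap 2 3) (swap 1 2) (swap 1 2 * swap 1 3) (swap 0 1 * swap 1 2)
    (swap 0 1 * swap 1 2 * swap 1 3) (swap 1 2)
    (by decide) (by decide) (by decide) (by decide)
  have := square (swap 2 3) (swap 1 3) (swap 1 2 * swap 2 3) (swap 0 1 * swap 1 3)
    (swap 0 1 * swap 1 2 * swap 2 3) (swap 1 3)
    (by decide) (by decide) (by decide) (by decide)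
  have := square (swap 1 2 * swap 2 3) 1 (swap 1 2 * swap 2 3) (swap 0 1 * swap 0 2)
    (swap 0 1 * swap 0 2 * swap 2 3) (swap 1 2)
    (by decide) (by decide) (by decide) (by decide)
  have := square (swap 1 2) (swap 1 2) 1 (swap 0 2 * swap 1 3) (swap 0 2) (swap 1 3)
    (by decide) (by decide) (by decide) (by decide)
  have := square (swap 1 2) (swap 1 3) (swap 1 2 * swap 1 3) (swap 0 2 * swap 2 3)
    (swap 0 1 * swap 0 2 * swap 1 3) (swap 2 3)
    (by decide) (by decide) (by decide) (by decide)
  have := square (swap 0 1 * swap 1 2) 1 (swap 0 1 * swap 1 2) (swap 0 2 * swap 2 3) (swap 0 2)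
    (swap 0 1 * swap 1 2 * swap 2 3)
    (by decide) (by decide) (by decide) (by decide)
  have := square (swap 0 1 * swap 1 2 * swap 2 3) (swap 1 2) (swap 0 1 * swap 1 3)
    (swap 0 1 * swap 0 2) (swap 0 1 * swap 0 2 * swap 1 3) (swap 0 1)
    (by decide) (by decide) (by decide) (by decide)
  have := square (swap 0 1 * swap 1 2 * swap 2 3) (swap 1 3) (swap 0 1 * swap 2 3)
    (swap 0 2 * swap 1 3) (swap 0 1 * swap 0 2 * swap 2 3) (swap 0 1 * swap 1 2 * swap 1 3)
    (by decide) (by decide) (by decide) (by decide)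
  have := even 1 (by decide)
  have := even (swap 0 1 * swap 2 3) (by decide)
  have := even (swap 1 2 * swap 1 3) (by decide)
  have := even (swap 0 1 * swap 1 2) (by decide)
  have := even (swap 1 2 * swap 2 3) (by decide)
  have := even (swap 0 1 * swap 1 3) (by decide)
  have := even (swap 0 1 * swap 0 2) (by decide)
  have := even (swap 0 2 * swap 1 3) (by decide)
  have := even (swap 0 2 * swap 2 3) (by decide)
  have := odd (swap 2 3) (by decide)
  have := odd (swap 0 1) (by decide)
  have := odd (swap 1 2) (by decide)
  have := odd (swap 0 1 * swap 1 2 * swap 1 3) (by decide)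
  have := odd (swap 0 1 * swap 1 2 * swap 2 3) (by decide)
  have := odd (swap 1 3) (by decide)
  have := odd (swap 0 1 * swap 0 2 * swap 2 3) (by decide)
  have := odd (swap 0 2) (by decide)
  have := odd (swap 0 1 * swap 0 2 * swap 1 3) (by decide)
  omega

/-- there is no weakly admissible continuous map on the 2-skeleton of
`Δ^{S₄}` with values in `U(4)`; in particular there is no admissible map. -/
theorem no_weaklyAdmissible_on_two_skeleton :
    (¬ ∃ u, WeaklyAdmissible 4 2 u) ∧ (¬ ∃ u, Admissible 4 2 u) := by
  have key : ¬ ∃ u, WeaklyAdmissible 4 2 u := by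
    rintro ⟨u, hu⟩
    choose m hm even odd using hu.exists_potential_eq
    refine not_square_identity_of_parity m even odd fun r p => ?_
    have h := hu.potential_square r p
    rw [hm (r * p⁻¹), hm (r * (swap 0 1 * swap 2 3) * p⁻¹), hm (r * swap 0 1 * p⁻¹),
      hm (r * swap 2 3 * p⁻¹)] at h
    have hpi : (Real.pi * Complex.I : ℂ) ≠ 0 :=
      mul_ne_zero (Complex.ofReal_ne_zero.mpr Real.pi_ne_zero) Complex.I_ne_zero
    have h' := mul_right_cancel₀ hpi (show
      ((m (r * p⁻¹) + m (r * (swap 0 1 * swap 2 3) * p⁻¹) : ℤ) : ℂ) * (Real.pi * Complex.I) =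
      ((m (r * swap 0 1 * p⁻¹) + m (r * swap 2 3 * p⁻¹) : ℤ) : ℂ) * (Real.pi * Complex.I) by
        push_cast
        linear_combination h)
    exact_mod_cast h'
  exact ⟨key, fun ⟨u, hu⟩ => key ⟨u, hu.1⟩⟩
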